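/- Under the standing assumptions (Θ nonempty convex with K < ∞, C closed convex containing 0, C∩C^0 compact), there exists ŷ ∈ C∩C^0 such that inf_{θ∈Θ} g^θ(ŷ) = sup_{y∈C∩C^0} inf_{θ∈Θ} g^θ(y) = inf_{θ∈Θ} sup_{y∈C∩C^0} g^θ(y). -/

import Mathlib

open MeasureTheory Filter Set
open scoped ENNReal NNReal Topology

noncomputable section

/-- The positive part of an extended real number, as an element of `ℝ≥0∞`. -/
def EReal.posPart (x : EReal) : ℝ≥0∞ := if x = ⊤ then ⊤ else ENNReal.ofReal x.toReal

/-- Integral of an `EReal`-valued function, defined as the difference of the lintegrals of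
the positive and negative parts, with the conventions of `EReal` arithmetic
(in particular `∞ - ∞ = -∞`). -/
def eIntegral {α : Type*} [MeasurableSpace α] (F : Measure α) (f : α → EReal) : EReal :=
  ((∫⁻ z, (f z).posPart ∂F : ℝ≥0∞) : EReal) - ((∫⁻ z, (-(f z)).posPart ∂F : ℝ≥0∞) : EReal)

/-- The dot product `y^⊤ z` on `ℝ^d`. -/
def dotp {d : ℕ} (y z : EuclideanSpace ℝ (Fin d)) : ℝ := ∑ i, y i * z i

/-- The quadratic form `y^⊤ c y`. -/
def quadf {d : ℕ} (c : Matrix (Fin d) (Fin d) ℝ) (y : EuclideanSpace ℝ (Fin d)) : ℝ :=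
  ∑ i, ∑ j, c i j * y i * y j

/-- The (Frobenius) norm `|c|` of a matrix. -/
def matNorm {d : ℕ} (c : Matrix (Fin d) (Fin d) ℝ) : ℝ :=
  Real.sqrt (∑ i, ∑ j, (c i j) ^ 2)

/-- A Lévy measure on `ℝ^d`: a (Borel) measure with `F({0}) = 0` and `∫ |z|² ∧ 1 F(dz) < ∞`. -/
def IsLevyMeasure {d : ℕ} (F : Measure (EuclideanSpace ℝ (Fin d))) : Prop :=
  F {0} = 0 ∧ ∫⁻ z, ENNReal.ofReal (min (‖z‖ ^ 2) 1) ∂F < ⊤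

/-- A truncation function: bounded, measurable, equal to the identity near the origin. -/
structure IsTruncation {d : ℕ}
    (h : EuclideanSpace ℝ (Fin d) → EuclideanSpace ℝ (Fin d)) : Prop where
  measurable : Measurable h
  bounded : ∃ M : ℝ, ∀ z, ‖h z‖ ≤ M
  eq_id_near_zero : ∃ δ : ℝ, 0 < δ ∧ ∀ z, ‖z‖ < δ → h z = z

/-- The integrand `I_y(z)`, as an extended real number:
`log(1+y^⊤z) - y^⊤h(z)` if `p = 0`, and `p⁻¹(1+y^⊤z)^p - p⁻¹ - y^⊤h(z)` if `p ≠ 0`,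
with the conventions `log 0 = -∞` and `0^p = +∞` for `p < 0` (so that the integrand
is `-∞` on `{1 + y^⊤z ≤ 0}` when `p ≤ 0`). -/
def Ifun {d : ℕ} (p : ℝ) (h : EuclideanSpace ℝ (Fin d) → EuclideanSpace ℝ (Fin d))
    (y z : EuclideanSpace ℝ (Fin d)) : EReal :=
  if 0 < 1 + dotp y z then
    (if p = 0 then ((Real.log (1 + dotp y z) - dotp y (h z) : ℝ) : EReal)
      else ((p⁻¹ * (1 + dotp y z) ^ p - p⁻¹ - dotp y (h z) : ℝ) : EReal))
  else if p ≤ 0 then (⊥ : EReal)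
  else ((p⁻¹ * (1 + dotp y z) ^ p - p⁻¹ - dotp y (h z) : ℝ) : EReal)

/-- The function `g^{(b,c,F)}(y) = y^⊤b + ((p-1)/2)·y^⊤cy + ∫ I_y(z) F(dz)`. -/
def gfun {d : ℕ} (p : ℝ) (h : EuclideanSpace ℝ (Fin d) → EuclideanSpace ℝ (Fin d))
    (b : EuclideanSpace ℝ (Fin d)) (c : Matrix (Fin d) (Fin d) ℝ)
    (F : Measure (EuclideanSpace ℝ (Fin d))) (y : EuclideanSpace ℝ (Fin d)) : EReal :=
  ((dotp y b + (p - 1) / 2 * quadf c y : ℝ) : EReal) + eIntegral F (fun z => Ifun p h y z)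

/-- Triples `θ = (b, c, F)`. -/
abbrev Triple (d : ℕ) :=
  EuclideanSpace ℝ (Fin d) × Matrix (Fin d) (Fin d) ℝ × Measure (EuclideanSpace ℝ (Fin d))

/-- `g^θ(y)` for a triple `θ = (b,c,F)`. -/
def gTheta {d : ℕ} (p : ℝ) (h : EuclideanSpace ℝ (Fin d) → EuclideanSpace ℝ (Fin d))
    (θ : Triple d) (y : EuclideanSpace ℝ (Fin d)) : EReal :=
  gfun p h θ.1 θ.2.1 θ.2.2 y

/-- The integrand appearing in the definition of the constant `K`, depending on `p`
(and an extra parameter `ε > 0` when `p ∈ (0,1)`). -/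
def Kintegrand {d : ℕ} (p ε : ℝ) (z : EuclideanSpace ℝ (Fin d)) : ℝ :=
  if p = 0 then min (‖z‖ ^ 2) (Real.log (1 + ‖z‖))
  else if 0 < p then min (‖z‖ ^ 2) (‖z‖ ^ (p * (1 + ε)))
  else min (‖z‖ ^ 2) 1

/-- The natural constraints `C⁰ = ∩_{F ∈ L_Θ} {y : F({z : y^⊤z < -1}) = 0}`. -/
def natC {d : ℕ} (Θ : Set (Triple d)) : Set (EuclideanSpace ℝ (Fin d)) :=
  {y | ∀ θ ∈ Θ, θ.2.2 {z | dotp y z < -1} = 0}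

/-- The sets `C⁰ₙ = ∩_{F ∈ L_Θ} {y : F({z : y^⊤z < -1 + 1/n}) = 0}`. -/
def natCn {d : ℕ} (Θ : Set (Triple d)) (n : ℕ) : Set (EuclideanSpace ℝ (Fin d)) :=
  {y | ∀ θ ∈ Θ, θ.2.2 {z | dotp y z < -1 + 1 / (n : ℝ)} = 0}

/-- The finite measure `|z|² ∧ 1 · F`. -/
def sq1Measure {d : ℕ} (F : Measure (EuclideanSpace ℝ (Fin d))) :
    Measure (EuclideanSpace ℝ (Fin d)) :=
  F.withDensity (fun z => ENNReal.ofReal (min (‖z‖ ^ 2) 1))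

/-- The standing assumptions of the paper: `p = 0` or `p ∈ (-∞,0) ∪ (0,1)`, `ε > 0`,
`h` is a truncation function, `Θ` is a nonempty convex set of Lévy triplets with `K < ∞`,
`C` is closed, convex and contains `0`, and `C ∩ C⁰` is compact. -/
structure Standing {d : ℕ} (p ε : ℝ)
    (h : EuclideanSpace ℝ (Fin d) → EuclideanSpace ℝ (Fin d))
    (Θ : Set (Triple d)) (C : Set (EuclideanSpace ℝ (Fin d))) : Prop where
  p_range : p = 0 ∨ p < 0 ∨ (0 < p ∧ p < 1)
  eps_pos : 0 < ε
  trunc : IsTruncation h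
  Theta_nonempty : Θ.Nonempty
  Theta_psd : ∀ θ ∈ Θ, (θ.2.1).PosSemidef
  Theta_levy : ∀ θ ∈ Θ, IsLevyMeasure θ.2.2
  Theta_convex : ∀ θ₁ ∈ Θ, ∀ θ₂ ∈ Θ, ∀ t : ℝ, 0 ≤ t → t ≤ 1 →
    (t • θ₁.1 + (1 - t) • θ₂.1, t • θ₁.2.1 + (1 - t) • θ₂.2.1,
      ENNReal.ofReal t • θ₁.2.2 + ENNReal.ofReal (1 - t) • θ₂.2.2) ∈ Θ
  K_finite : ∃ K : ℝ, ∀ θ ∈ Θ,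
    (∫⁻ z, ENNReal.ofReal (Kintegrand p ε z) ∂θ.2.2) ≠ ⊤ ∧
    ‖θ.1‖ + matNorm θ.2.1 + (∫⁻ z, ENNReal.ofReal (Kintegrand p ε z) ∂θ.2.2).toReal ≤ K
  C_closed : IsClosed C
  C_convex : Convex ℝ C
  C_zero : (0 : EuclideanSpace ℝ (Fin d)) ∈ C
  CC0_compact : IsCompact (C ∩ natC Θ)

/-- The real utility function `log x` for `p = 0`, and `p⁻¹ x ^ p - p⁻¹` for `p ≠ 0`. -/
def powUtil (p x : ℝ) : ℝ := if p = 0 then Real.log x else p⁻¹ * x ^ p - p⁻¹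

lemma powUtil_le {p w : ℝ} (hp : p < 1) (hw : 0 ≤ w) (hg : 0 < w ∨ 0 < p) :
    powUtil p w ≤ w - 1 := by
  unfold powUtil
  rcases lt_trichotomy p 0 with h | h | h
  · have hw : 0 < w := hg.resolve_right (by linarith)
    rw [if_neg h.ne]
    have h1 : 1 + p * (w - 1) ≤ w ^ p := by
      rw [Real.rpow_def_of_pos hw]
      have := Real.add_one_le_exp (Real.log w * p)
      nlinarith [Real.log_le_sub_one_of_pos hw]
    have h2 : p⁻¹ * w ^ p ≤ p⁻¹ * (1 + p * (w - 1)) :=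
      mul_le_mul_of_nonpos_left h1 (inv_nonpos.2 h.le)
    have h3 : p⁻¹ * (1 + p * (w - 1)) = p⁻¹ + (w - 1) := by
      rw [mul_add, ← mul_assoc, inv_mul_cancel₀ h.ne, mul_one, one_mul]
    linarith
  · have hw : 0 < w := hg.resolve_right (by linarith)
    rw [if_pos h]
    exact Real.log_le_sub_one_of_pos hw
  · rw [if_neg h.ne']
    have h1 := rpow_one_add_le_one_add_mul_self (s := w - 1) (by linarith) h.le hp.le
    rw [add_sub_cancel] at h1
    have h2 : p⁻¹ * w ^ p ≤ p⁻¹ * (1 + p * (w - 1)) :=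
      mul_le_mul_of_nonneg_left h1 (inv_nonneg.2 h.le)
    have h3 : p⁻¹ * (1 + p * (w - 1)) = p⁻¹ + (w - 1) := by
      rw [mul_add, ← mul_assoc, inv_mul_cancel₀ h.ne', mul_one, one_mul]
    linarith

lemma powUtil_concave {p v w a b : ℝ} (hp : p < 1) (hv : 0 ≤ v) (hgv : 0 < v ∨ 0 < p)
    (hw : 0 ≤ w) (hgw : 0 < w ∨ 0 < p) (ha : 0 ≤ a) (hb : 0 ≤ b) (hab : a + b = 1) :
    a * powUtil p v + b * powUtil p w ≤ powUtil p (a * v + b * w) := by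
  unfold powUtil
  rcases lt_trichotomy p 0 with h | h | h
  · have hw : 0 < w := hgw.resolve_right (by linarith)
    have hv : 0 < v := hgv.resolve_right (by linarith)
    simp only [if_neg h.ne]
    have hlog : a * Real.log v + b * Real.log w ≤ Real.log (a * v + b * w) := by
      simpa using strictConcaveOn_log_Ioi.concaveOn.2 hv hw ha hb hab
    have hpos : 0 < a * v + b * w := by
      simpa using convex_Ioi (0 : ℝ) hv hw ha hb hab
    have h1 : (a * v + b * w) ^ p ≤ a * v ^ p + b * w ^ p := by
      rw [Real.rpow_def_of_pos hw, Real.rpow_def_of_pos hv, Real.rpow_def_of_pos hpos]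
      have := convexOn_exp.2 (mem_univ (Real.log v * p)) (mem_univ (Real.log w * p)) ha hb hab
      simp only [smul_eq_mul] at this
      refine le_trans (Real.exp_le_exp.2 ?_) this
      nlinarith
    have h2 := mul_le_mul_of_nonpos_left h1 (inv_nonpos.2 h.le)
    have h3 : a * p⁻¹ + b * p⁻¹ = p⁻¹ := by rw [← add_mul, hab, one_mul]
    linarith
  · have hw : 0 < w := hgw.resolve_right (by linarith)
    have hv : 0 < v := hgv.resolve_right (by linarith)
    simp only [if_pos h]
    simpa using strictConcaveOn_log_Ioi.concaveOn.2 hv hw ha hb hab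
  · simp only [if_neg h.ne']
    have h1 : a * v ^ p + b * w ^ p ≤ (a * v + b * w) ^ p := by
      simpa using (Real.concaveOn_rpow h.le hp.le).2 hv hw ha hb hab
    have h2 := mul_le_mul_of_nonneg_left h1 (inv_nonneg.2 h.le)
    have h3 : a * p⁻¹ + b * p⁻¹ = p⁻¹ := by rw [← add_mul, hab, one_mul]
    linarith

lemma continuousAt_powUtil {p w : ℝ} (hg : 0 < w ∨ 0 < p) : ContinuousAt (powUtil p) w := by
  unfold powUtil
  by_cases h : p = 0
  · simp only [if_pos h]
    exact Real.continuousAt_log (hg.resolve_right (by linarith)).ne'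
  · simp only [if_neg h]
    exact ((Real.continuousAt_rpow_const w p (hg.imp ne_of_gt le_of_lt)).const_mul _).sub_const _

lemma tendsto_powUtil_nhdsGT_zero {p : ℝ} (hp : p ≤ 0) :
    Tendsto (powUtil p) (𝓝[>] 0) atBot := by
  unfold powUtil
  rcases hp.lt_or_eq with h | h
  · simp only [if_neg h.ne]
    exact tendsto_atBot_add_const_right _ _
      ((tendsto_rpow_neg_nhdsGT_zero h).const_mul_atTop_of_neg (inv_lt_zero.2 h))
  · simp only [if_pos h]
    exact Real.tendsto_log_nhdsGT_zero

lemma measurable_powUtil (p : ℝ) : Measurable (powUtil p) := by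
  unfold powUtil
  split_ifs
  · exact Real.measurable_log
  · fun_prop

/-- `Kintegrand` as a function of the norm. -/
def radialWeight (p ε r : ℝ) : ℝ :=
  if p = 0 then min (r ^ 2) (Real.log (1 + r))
  else if 0 < p then min (r ^ 2) (r ^ (p * (1 + ε)))
  else min (r ^ 2) 1

lemma radialWeight_nonneg (p ε : ℝ) {r : ℝ} (hr : 0 ≤ r) : 0 ≤ radialWeight p ε r := by
  unfold radialWeight
  split_ifs
  · exact le_min (by positivity) (Real.log_nonneg (by linarith))
  · positivity
  · positivity

lemma measurable_radialWeight (p ε : ℝ) : Measurable (radialWeight p ε) := by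
  unfold radialWeight
  split_ifs <;> fun_prop

/-- Away from the origin, the utility of a wealth growing at most linearly in `r` is dominated by
a multiple of `radialWeight`. -/
lemma exists_mul_radialWeight_ge {p ε δ R M : ℝ} (hp : p < 1) (hε : 0 < ε) (hδ : 0 < δ)
    (hR : 0 ≤ R) (hM : 0 ≤ M) :
    ∃ A : ℝ, 0 ≤ A ∧ ∀ r, δ ≤ r → ∀ w, 0 ≤ w → w ≤ 1 + R * r → (0 < w ∨ 0 < p) →
      powUtil p w + M ≤ A * radialWeight p ε r := by
  unfold powUtil radialWeight
  rcases lt_trichotomy p 0 with h | h | h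
  · simp only [if_neg h.ne, if_neg h.not_gt]
    have hpi : p⁻¹ ≤ 0 := inv_nonpos.2 h.le
    have hm : 0 < min (δ ^ 2) 1 := by positivity
    refine ⟨(M - p⁻¹) / min (δ ^ 2) 1, div_nonneg (by linarith) hm.le, ?_⟩
    intro r hr w hw _ _
    have h1 : min (δ ^ 2) 1 ≤ min (r ^ 2) 1 := by gcongr
    have h2 : p⁻¹ * w ^ p ≤ 0 := mul_nonpos_of_nonpos_of_nonneg hpi (by positivity)
    have h3 : M - p⁻¹ ≤ (M - p⁻¹) / min (δ ^ 2) 1 * min (r ^ 2) 1 := by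
      rw [div_mul_eq_mul_div, le_div_iff₀ hm]
      exact mul_le_mul_of_nonneg_left h1 (by linarith)
    linarith
  · simp only [if_pos h]
    have hl : 0 < Real.log (1 + δ) := Real.log_pos (by linarith)
    set c := Real.log (1 + R) + M with hc
    have hc0 : 0 ≤ c := add_nonneg (Real.log_nonneg (by linarith)) hM
    have hA1 : 0 ≤ 1 / δ + c / δ ^ 2 := by positivity
    have hA2 : 0 ≤ 1 + c / Real.log (1 + δ) := by positivity
    refine ⟨(1 / δ + c / δ ^ 2) + (1 + c / Real.log (1 + δ)), by positivity, ?_⟩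
    intro r hr w hw hwr hg
    have hr0 : 0 < r := hδ.trans_le hr
    have hw : 0 < w := hg.resolve_right (by linarith)
    have hlr : Real.log (1 + δ) ≤ Real.log (1 + r) := Real.log_le_log (by linarith) (by linarith)
    have h1 : Real.log w ≤ Real.log (1 + R) + Real.log (1 + r) := by
      rw [← Real.log_mul (by positivity) (by positivity)]
      exact Real.log_le_log hw (by nlinarith)
    have h2 : Real.log (1 + r) ≤ r := by
      have := Real.log_le_sub_one_of_pos (show 0 < 1 + r by linarith)
      linarith
    have e1 : Real.log (1 + r) + c ≤ (1 / δ + c / δ ^ 2) * r ^ 2 := by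
      have e : r ≤ 1 / δ * r ^ 2 := by
        rw [div_mul_eq_mul_div, le_div_iff₀ hδ]; nlinarith
      have e' : c ≤ c / δ ^ 2 * r ^ 2 := by
        rw [div_mul_eq_mul_div, le_div_iff₀ (by positivity)]
        gcongr
      linarith
    have e2 : Real.log (1 + r) + c ≤ (1 + c / Real.log (1 + δ)) * Real.log (1 + r) := by
      have e' : c ≤ c / Real.log (1 + δ) * Real.log (1 + r) := by
        rw [div_mul_eq_mul_div, le_div_iff₀ (by positivity)]
        gcongr
      linarith
    refine le_trans (b := Real.log (1 + r) + c) (by linarith) ?_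
    rcases min_choice (r ^ 2) (Real.log (1 + r)) with hm | hm <;> rw [hm]
    · nlinarith [mul_nonneg hA2 (sq_nonneg r)]
    · nlinarith [mul_nonneg hA1 (hl.le.trans hlr)]
  · simp only [if_neg h.ne', if_pos h]
    set D := p⁻¹ * (1 / δ + R) ^ p + M / δ ^ p with hD
    have hD0 : 0 ≤ D := by positivity
    set q := p * (1 + ε) with hq
    have hpq : p ≤ q := by nlinarith
    have key : ∀ s, p ≤ s → ∀ r, δ ≤ r → r ^ p ≤ δ ^ (p - s) * r ^ s := by
      intro s hs r hr
      have hr0 : 0 < r := hδ.trans_le hr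
      have e : r ^ p = r ^ (p - s) * r ^ s := by rw [← Real.rpow_add hr0]; congr 1; ring
      rw [e]
      exact mul_le_mul_of_nonneg_right (Real.rpow_le_rpow_of_nonpos hδ hr (by linarith))
        (by positivity)
    refine ⟨D * (δ ^ (p - 2) + δ ^ (p - q)), by positivity, ?_⟩
    intro r hr w hw hwr hg
    have hr0 : 0 < r := hδ.trans_le hr
    have h1 : w ^ p ≤ (1 / δ + R) ^ p * r ^ p := by
      rw [← Real.mul_rpow (by positivity) hr0.le]
      refine Real.rpow_le_rpow hw (hwr.trans ?_) h.le
      have : 1 ≤ 1 / δ * r := by rw [div_mul_eq_mul_div, le_div_iff₀ hδ]; linarith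
      linarith
    have h2 : p⁻¹ * w ^ p ≤ p⁻¹ * (1 / δ + R) ^ p * r ^ p := by
      rw [mul_assoc]; exact mul_le_mul_of_nonneg_left h1 (by positivity)
    have h3 : M ≤ M / δ ^ p * r ^ p := by
      rw [div_mul_eq_mul_div, le_div_iff₀ (by positivity)]
      gcongr
    have h4 : p⁻¹ * w ^ p - p⁻¹ + M ≤ D * r ^ p := by
      have : 0 < p⁻¹ := by positivity
      rw [hD, add_mul]; linarith
    refine h4.trans ?_
    rw [mul_assoc]
    refine mul_le_mul_of_nonneg_left ?_ hD0
    have k2 := key 2 (by linarith) r hr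
    have kq := key q hpq r hr
    rw [Real.rpow_two] at k2
    rcases min_choice (r ^ 2) (r ^ q) with hm | hm <;> rw [hm]
    · have : 0 ≤ δ ^ (p - q) * r ^ 2 := by positivity
      linarith
    · have : 0 ≤ δ ^ (p - 2) * r ^ q := by positivity
      linarith

/-- Concavity of an `EReal`-valued function: its real hypograph over `X` is convex. -/
def ERealConcaveOn {E : Type*} [AddCommGroup E] [Module ℝ E] (X : Set E) (f : E → EReal) : Prop :=
  ∀ x ∈ X, ∀ y ∈ X, ∀ a b : ℝ, 0 ≤ a → 0 ≤ b → a + b = 1 → ∀ r s : ℝ,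
    (r : EReal) ≤ f x → (s : EReal) ≤ f y → ((a * r + b * s : ℝ) : EReal) ≤ f (a • x + b • y)

lemma exists_mixture_lt {E : Type*} [AddCommGroup E] [Module ℝ E] [TopologicalSpace E]
    {X : Set E} (hX : IsCompact X) (hXc : Convex ℝ X) {f g : E → EReal}
    (hf : UpperSemicontinuousOn f X) (hg : UpperSemicontinuousOn g X)
    (hf' : ∀ x ∈ X, f x < ⊤) (hg' : ∀ x ∈ X, g x < ⊤)
    (hfc : ERealConcaveOn X f) (hgc : ERealConcaveOn X g) {α : ℝ}
    (hα : ∀ x ∈ X, min (f x) (g x) < α) :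
    ∃ t : ℝ, 0 < t ∧ t < 1 ∧ ∀ x ∈ X, (t : EReal) * f x + ((1 - t : ℝ) : EReal) * g x < α := by
  have key : ∃ t : ℝ, 0 < t ∧ t < 1 ∧ ∀ x ∈ X, ∀ r s : ℝ, f x = r → g x = s →
      t * r + (1 - t) * s < α := by
    rcases X.eq_empty_or_nonempty with rfl | hne
    · exact ⟨1 / 2, by norm_num, by norm_num, by simp⟩
    obtain ⟨x₀, hx₀, hmax⟩ := (hf.inf hg).exists_isMaxOn hne hX
    obtain ⟨β, hβ, hβα⟩ := EReal.exists_between_coe_real (hα x₀ hx₀)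
    have hβα : β < α := by exact_mod_cast hβα
    have hminβ : ∀ x ∈ X, min (f x) (g x) < β := fun x hx => (hmax hx).trans_lt hβ
    obtain ⟨x₁, hx₁, hmax₁⟩ := hf.exists_isMaxOn hne hX
    obtain ⟨x₂, hx₂, hmax₂⟩ := hg.exists_isMaxOn hne hX
    obtain ⟨M₁, hM₁, -⟩ := EReal.exists_between_coe_real (hf' x₁ hx₁)
    obtain ⟨M₂, hM₂, -⟩ := EReal.exists_between_coe_real (hg' x₂ hx₂)
    set A : Set (ℝ × ℝ) := {q | ∃ x ∈ X, (q.1 : EReal) ≤ f x ∧ (q.2 : EReal) ≤ g x} with hA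
    have hAc : Convex ℝ A := by
      rintro ⟨r₁, s₁⟩ ⟨x, hx, h1, h2⟩ ⟨r₂, s₂⟩ ⟨y, hy, h3, h4⟩ a b ha hb hab
      exact ⟨a • x + b • y, hXc hx hy ha hb hab, hfc x hx y hy a b ha hb hab _ _ h1 h3,
        hgc x hx y hy a b ha hb hab _ _ h2 h4⟩
    have hdisj : Disjoint (Ioi β ×ˢ Ioi β : Set (ℝ × ℝ)) A := by
      rw [Set.disjoint_left]
      rintro ⟨r, s⟩ ⟨hr, hs⟩ ⟨x, hx, h1, h2⟩
      have : ((min r s : ℝ) : EReal) ≤ min (f x) (g x) := by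
        refine le_min (le_trans ?_ h1) (le_trans ?_ h2) <;> simp
      have := this.trans_lt (hminβ x hx)
      rw [EReal.coe_lt_coe_iff] at this
      exact absurd this (not_lt.2 (le_min (le_of_lt hr) (le_of_lt hs)))
    obtain ⟨l, u, hl, hu⟩ := geometric_hahn_banach_open
      ((convex_Ioi β).prod (convex_Ioi β)) (isOpen_Ioi.prod isOpen_Ioi) hAc hdisj
    set m := l (1, 0) with hm
    set n := l (0, 1) with hn
    have hlin : ∀ r s : ℝ, l (r, s) = r * m + s * n := by
      intro r s
      have : ((r, s) : ℝ × ℝ) = r • (1, 0) + s • (0, 1) := by simp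
      rw [this, map_add, map_smul, map_smul]; rfl
    have hl' : ∀ r s : ℝ, 0 < r → 0 < s → (β + r) * m + (β + s) * n < u := by
      intro r s hr hs
      rw [← hlin]
      exact hl _ ⟨by simpa using hr, by simpa using hs⟩
    have hm0 : m ≤ 0 := by
      by_contra! hpos
      have := hl' ((|u - β * m - β * n - n| + 1) / m) 1 (by positivity) one_pos
      rw [add_mul, div_mul_cancel₀ _ hpos.ne'] at this
      linarith [le_abs_self (u - β * m - β * n - n)]
    have hn0 : n ≤ 0 := by
      by_contra! hpos
      have := hl' 1 ((|u - β * m - β * n - m| + 1) / n) one_pos (by positivity)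
      rw [add_mul β _ n, div_mul_cancel₀ _ hpos.ne'] at this
      linarith [le_abs_self (u - β * m - β * n - m)]
    by_cases hdom : ∃ x ∈ X, f x ≠ ⊥ ∧ g x ≠ ⊥
    swap
    · push Not at hdom
      refine ⟨1 / 2, by norm_num, by norm_num, fun x hx r s hr hs => ?_⟩
      exact absurd hs (by rw [hdom x hx (by simp [hr])]; simp)
    have hmn : m + n < 0 := by
      obtain ⟨x, hx, h1, h2⟩ := hdom
      lift f x to ℝ using ⟨(hf' x hx).ne, h1⟩ with r hr
      lift g x to ℝ using ⟨(hg' x hx).ne, h2⟩ with s hs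
      have h3 := hu (r, s) ⟨x, hx, hr.le, hs.le⟩
      rw [hlin] at h3
      by_contra! hge
      have hm1 : m = 0 := by linarith
      have hn1 : n = 0 := by linarith
      have := hl' 1 1 one_pos one_pos
      simp only [hm1, hn1] at this h3
      linarith
    have hub : β * (m + n) ≤ u := by
      by_contra! hlt
      have := hl' ((β * (m + n) - u) / (-(m + n))) ((β * (m + n) - u) / (-(m + n)))
        (div_pos (by linarith) (by linarith)) (div_pos (by linarith) (by linarith))
      have e : (β * (m + n) - u) / (-(m + n)) * (m + n) = -(β * (m + n) - u) := by
        have := hmn.ne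
        field_simp
      linarith
    set lam := m / (m + n) with hlam
    have hlam0 : 0 ≤ lam := div_nonneg_of_nonpos hm0 hmn.le
    have hlam1 : lam ≤ 1 := (div_le_one_of_neg hmn).2 (by linarith)
    have hle : ∀ x ∈ X, ∀ r s : ℝ, f x = r → g x = s → lam * r + (1 - lam) * s ≤ β := by
      intro x hx r s hr hs
      have h3 := hu (r, s) ⟨x, hx, hr.ge, hs.ge⟩
      rw [hlin] at h3
      have h4 : lam * r + (1 - lam) * s = (r * m + s * n) / (m + n) := by
        rw [hlam]; have := hmn.ne; field_simp; ring
      rw [h4, div_le_iff_of_neg hmn]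
      linarith
    set M := max (max M₁ M₂) β with hM
    have hMβ : β ≤ M := le_max_right _ _
    obtain ⟨e, he0, he1, heM⟩ : ∃ e : ℝ, 0 < e ∧ e < 1 ∧ e * (M - β) < α - β := by
      refine ⟨min (1 / 2) ((α - β) / (2 * (M - β + 1))), ?_, ?_, ?_⟩
      · have : 0 < M - β + 1 := by linarith
        have : 0 < α - β := by linarith
        positivity
      · exact (min_le_left _ _).trans_lt (by norm_num)
      · have h0 : 0 < M - β + 1 := by linarith
        calc _ ≤ (α - β) / (2 * (M - β + 1)) * (M - β) :=
              mul_le_mul_of_nonneg_right (min_le_right _ _) (by linarith)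
          _ < α - β := by
              rw [div_mul_eq_mul_div, div_lt_iff₀ (by linarith)]
              nlinarith
    refine ⟨(1 - e) * lam + e / 2, by nlinarith, by nlinarith, fun x hx r s hr hs => ?_⟩
    have h1 := hle x hx r s hr hs
    have hr' : r ≤ M := by
      have : (r : EReal) < M₁ := hr ▸ (hmax₁ hx).trans_lt hM₁
      exact (EReal.coe_lt_coe_iff.1 this).le.trans ((le_max_left _ _).trans (le_max_left _ _))
    have hs' : s ≤ M := by
      have : (s : EReal) < M₂ := hs ▸ (hmax₂ hx).trans_lt hM₂
      exact (EReal.coe_lt_coe_iff.1 this).le.trans ((le_max_right _ _).trans (le_max_left _ _))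
    have e1 : ((1 - e) * lam + e / 2) * r + (1 - ((1 - e) * lam + e / 2)) * s
        = (1 - e) * (lam * r + (1 - lam) * s) + e * ((r + s) / 2) := by ring
    rw [e1]
    nlinarith [mul_le_mul_of_nonneg_left h1 (by linarith : 0 ≤ 1 - e)]
  obtain ⟨t, ht0, ht1, ht⟩ := key
  refine ⟨t, ht0, ht1, fun x hx => ?_⟩
  have h1 := hf' x hx
  have h2 := hg' x hx
  have h3 := ht x hx
  generalize f x = a at *
  generalize g x = b at *
  induction a with
  | top => exact absurd h1 (lt_irrefl _)
  | bot => simp [EReal.coe_mul_bot_of_pos ht0]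
  | coe r =>
    induction b with
    | top => exact absurd h2 (lt_irrefl _)
    | bot =>
      rw [EReal.coe_mul_bot_of_pos (sub_pos.2 ht1), EReal.add_bot]
      exact EReal.bot_lt_coe _
    | coe s => exact_mod_cast h3 r s rfl rfl

/-- A minimax inequality without topology on `Θ`: if the finite infima of a mixture-closed family
of concave upper semicontinuous functions stay below `α`, so does one member of the family. -/
lemma exists_forall_lt_of_finset {ι E : Type*} [AddCommGroup E] [Module ℝ E] [TopologicalSpace E]
    {Θ : Set ι} (hΘ : Θ.Nonempty) {f : ι → E → EReal} {α : ℝ} (T : Finset ι) :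
    ∀ (X : Set E), IsCompact X → Convex ℝ X →
    (∀ θ ∈ Θ, UpperSemicontinuousOn (f θ) X) →
    (∀ θ ∈ Θ, ∀ x ∈ X, f θ x < ⊤) →
    (∀ θ ∈ Θ, ERealConcaveOn X (f θ)) →
    (∀ θ₁ ∈ Θ, ∀ θ₂ ∈ Θ, ∀ t : ℝ, 0 < t → t < 1 → ∃ θ ∈ Θ, ∀ x ∈ X,
      f θ x ≤ (t : EReal) * f θ₁ x + ((1 - t : ℝ) : EReal) * f θ₂ x) →
    (∀ θ ∈ T, θ ∈ Θ) → (∀ x ∈ X, ∃ θ ∈ T, f θ x < α) →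
    ∃ θ ∈ Θ, ∀ x ∈ X, f θ x < α := by
  classical
  induction T using Finset.induction_on with
  | empty =>
    intro X _ _ _ _ _ _ _ h
    obtain ⟨θ, hθ⟩ := hΘ
    exact ⟨θ, hθ, fun x hx => by simpa using h x hx⟩
  | insert θ₀ T _ ih =>
    intro X hX hXc husc htop hconc hmix hT h
    have hθ₀ : θ₀ ∈ Θ := hT _ (Finset.mem_insert_self _ _)
    set X' := X ∩ f θ₀ ⁻¹' Ici (α : EReal) with hX'
    have hsub : X' ⊆ X := inter_subset_left
    obtain ⟨θ₁, hθ₁, h₁⟩ := ih X' ((husc _ hθ₀).isCompact_inter_preimage_Ici hX _)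
      (fun x hx y hy a b ha hb hab => ⟨hXc hx.1 hy.1 ha hb hab, by
        have := hconc _ hθ₀ x hx.1 y hy.1 a b ha hb hab α α hx.2 hy.2
        rwa [← add_mul, hab, one_mul] at this⟩)
      (fun θ hθ => (husc θ hθ).mono hsub) (fun θ hθ x hx => htop θ hθ x (hsub hx))
      (fun θ hθ x hx y hy => hconc θ hθ x (hsub hx) y (hsub hy))
      (fun θ₁ h₁ θ₂ h₂ t ht0 ht1 => by
        obtain ⟨θ, hθ, hθ'⟩ := hmix θ₁ h₁ θ₂ h₂ t ht0 ht1
        exact ⟨θ, hθ, fun x hx => hθ' x (hsub hx)⟩)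
      (fun θ hθ => hT θ (Finset.mem_insert_of_mem hθ))
      (fun x hx => by
        obtain ⟨θ, hθ, hlt⟩ := h x hx.1
        rcases Finset.mem_insert.1 hθ with rfl | hθ
        · exact absurd hlt (not_lt.2 hx.2)
        · exact ⟨θ, hθ, hlt⟩)
    obtain ⟨t, ht0, ht1, ht⟩ := exists_mixture_lt hX hXc (husc _ hθ₁) (husc _ hθ₀) (htop _ hθ₁)
      (htop _ hθ₀) (hconc _ hθ₁) (hconc _ hθ₀) (α := α) (fun x hx => by
        by_cases hx' : f θ₀ x < α
        · exact (min_le_right _ _).trans_lt hx'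
        · exact (min_le_left _ _).trans_lt (h₁ x ⟨hx, not_lt.1 hx'⟩))
    obtain ⟨θ, hθ, hθ'⟩ := hmix θ₁ hθ₁ θ₀ hθ₀ t ht0 ht1
    exact ⟨θ, hθ, fun x hx => (hθ' x hx).trans_lt (ht x hx)⟩

/-- Minimax theorem for a mixture-closed family of concave upper semicontinuous `EReal`-valued
functions on a compact convex set. -/
theorem exists_minimax {ι E : Type*} [AddCommGroup E] [Module ℝ E] [TopologicalSpace E]
    {Θ : Set ι} (hΘ : Θ.Nonempty) {f : ι → E → EReal} {X : Set E} (hne : X.Nonempty)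
    (hX : IsCompact X) (hXc : Convex ℝ X)
    (husc : ∀ θ ∈ Θ, UpperSemicontinuousOn (f θ) X)
    (htop : ∀ θ ∈ Θ, ∀ x ∈ X, f θ x < ⊤)
    (hconc : ∀ θ ∈ Θ, ERealConcaveOn X (f θ))
    (hmix : ∀ θ₁ ∈ Θ, ∀ θ₂ ∈ Θ, ∀ t : ℝ, 0 < t → t < 1 → ∃ θ ∈ Θ, ∀ x ∈ X,
      f θ x ≤ (t : EReal) * f θ₁ x + ((1 - t : ℝ) : EReal) * f θ₂ x) :
    ∃ xhat ∈ X, (⨅ θ ∈ Θ, f θ xhat) = (⨆ x ∈ X, ⨅ θ ∈ Θ, f θ x) ∧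
      (⨆ x ∈ X, ⨅ θ ∈ Θ, f θ x) = ⨅ θ ∈ Θ, ⨆ x ∈ X, f θ x := by
  obtain ⟨xhat, hxhat, hmax⟩ := (upperSemicontinuousOn_biInf husc).exists_isMaxOn hne hX
  have hsup : (⨅ θ ∈ Θ, f θ xhat) = (⨆ x ∈ X, ⨅ θ ∈ Θ, f θ x) :=
    le_antisymm (le_iSup₂ (f := fun x (_ : x ∈ X) => ⨅ θ ∈ Θ, f θ x) xhat hxhat)
      (iSup₂_le fun x hx => hmax hx)
  refine ⟨xhat, hxhat, hsup, le_antisymm ?_ ?_⟩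
  · refine iSup₂_le fun x hx => le_iInf₂ fun θ hθ => ?_
    exact (iInf₂_le θ hθ).trans (le_iSup₂ (f := fun x (_ : x ∈ X) => f θ x) x hx)
  · rw [← EReal.le_of_forall_lt_iff_le]
    intro α hα
    have hempty : X ∩ ⋂ θ ∈ Θ, f θ ⁻¹' Ici (α : EReal) = ∅ := by
      rw [Set.eq_empty_iff_forall_notMem]
      rintro x ⟨hx, hx'⟩
      have h1 : (α : EReal) ≤ ⨅ θ ∈ Θ, f θ x :=
        le_iInf₂ fun θ hθ => by simpa using Set.mem_iInter₂.1 hx' θ hθ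
      exact absurd (h1.trans (le_iSup₂ (f := fun x (_ : x ∈ X) => ⨅ θ ∈ Θ, f θ x) x hx))
        (not_le.2 hα)
    obtain ⟨u, hu⟩ :=
      (UpperSemicontinuousOn.inter_biInter_preimage_Ici_eq_empty_iff_exists_finset hX husc).1 hempty
    classical
    obtain ⟨θ, hθ, hlt⟩ := exists_forall_lt_of_finset hΘ (u.image Subtype.val) X hX hXc husc htop
      hconc hmix (by simp +contextual) (fun x hx => by
        obtain ⟨i, hi, hlt⟩ := hu x hx
        exact ⟨i, Finset.mem_image_of_mem _ hi, hlt⟩)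
    exact (iInf₂_le θ hθ).trans (iSup₂_le fun x hx => (hlt x hx).le)

@[simp] lemma EReal.posPart_coe (x : ℝ) : (x : EReal).posPart = ENNReal.ofReal x := by
  simp [EReal.posPart]

section Integrand

variable {d : ℕ}

lemma dotp_combo (a b : ℝ) (x y z : EuclideanSpace ℝ (Fin d)) :
    dotp (a • x + b • y) z = a * dotp x z + b * dotp y z := by
  simp only [dotp, Finset.mul_sum, ← Finset.sum_add_distrib]
  refine Finset.sum_congr rfl fun i _ => ?_
  simp; ring

lemma dotp_combo_right (a b : ℝ) (x y z : EuclideanSpace ℝ (Fin d)) :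
    dotp z (a • x + b • y) = a * dotp z x + b * dotp z y := by
  simp only [dotp, Finset.mul_sum, ← Finset.sum_add_distrib]
  refine Finset.sum_congr rfl fun i _ => ?_
  simp; ring

lemma abs_dotp_le (y z : EuclideanSpace ℝ (Fin d)) : |dotp y z| ≤ ‖y‖ * ‖z‖ := by
  have h : dotp y z = inner ℝ z y := by
    simp [dotp, PiLp.inner_apply]
  rw [h, mul_comm]
  exact abs_real_inner_le_norm z y

lemma continuous_dotp_left (z : EuclideanSpace ℝ (Fin d)) : Continuous fun y => dotp y z := by
  unfold dotp; fun_prop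

lemma continuous_dotp_right (y : EuclideanSpace ℝ (Fin d)) : Continuous fun z => dotp y z := by
  unfold dotp; fun_prop

lemma continuous_quadf (c : Matrix (Fin d) (Fin d) ℝ) : Continuous (quadf c) := by
  unfold quadf; fun_prop

lemma quadf_combo_matrix (a b : ℝ) (c₁ c₂ : Matrix (Fin d) (Fin d) ℝ)
    (y : EuclideanSpace ℝ (Fin d)) :
    quadf (a • c₁ + b • c₂) y = a * quadf c₁ y + b * quadf c₂ y := by
  simp only [quadf, Finset.mul_sum, ← Finset.sum_add_distrib]
  refine Finset.sum_congr rfl fun i _ => Finset.sum_congr rfl fun j _ => ?_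
  simp; ring

lemma quadf_nonneg {c : Matrix (Fin d) (Fin d) ℝ} (hc : c.PosSemidef)
    (y : EuclideanSpace ℝ (Fin d)) : 0 ≤ quadf c y := by
  have h := hc.dotProduct_mulVec_nonneg y.ofLp
  refine h.trans_eq ?_
  simp only [quadf, dotProduct, Matrix.mulVec, Finset.mul_sum]
  refine Finset.sum_congr rfl fun i _ => Finset.sum_congr rfl fun j _ => ?_
  simp; ring

lemma quadf_convex {c : Matrix (Fin d) (Fin d) ℝ} (hc : c.PosSemidef) {a b : ℝ} (ha : 0 ≤ a)
    (hb : 0 ≤ b) (hab : a + b = 1) (x y : EuclideanSpace ℝ (Fin d)) :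
    quadf c (a • x + b • y) ≤ a * quadf c x + b * quadf c y := by
  have h : a * quadf c x + b * quadf c y - quadf c (a • x + b • y) = a * b * quadf c (x - y) := by
    obtain rfl : b = 1 - a := by linarith
    simp only [quadf, Finset.mul_sum, ← Finset.sum_add_distrib, ← Finset.sum_sub_distrib]
    refine Finset.sum_congr rfl fun i _ => Finset.sum_congr rfl fun j _ => ?_
    simp; ring
  have := mul_nonneg (mul_nonneg ha hb) (quadf_nonneg hc (x - y))
  linarith

variable {p : ℝ} {h : EuclideanSpace ℝ (Fin d) → EuclideanSpace ℝ (Fin d)}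
  {B : EuclideanSpace ℝ (Fin d) → ℝ} {F : Measure (EuclideanSpace ℝ (Fin d))}

lemma Ifun_eq (y z : EuclideanSpace ℝ (Fin d)) :
    Ifun p h y z = if 0 < 1 + dotp y z ∨ 0 < p then
      ((powUtil p (1 + dotp y z) - dotp y (h z) : ℝ) : EReal) else ⊥ := by
  unfold Ifun powUtil
  split_ifs <;> first | rfl | grind

/-- The gap between a dominating function `B` and the integrand `Ifun`. -/
def gap (p : ℝ) (h : EuclideanSpace ℝ (Fin d) → EuclideanSpace ℝ (Fin d))
    (B : EuclideanSpace ℝ (Fin d) → ℝ) (y z : EuclideanSpace ℝ (Fin d)) : ℝ≥0∞ :=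
  if 0 < 1 + dotp y z ∨ 0 < p then
    ENNReal.ofReal (B z - (powUtil p (1 + dotp y z) - dotp y (h z))) else ⊤

lemma measurable_gap (hh : Measurable h) (hB : Measurable B) (y : EuclideanSpace ℝ (Fin d)) :
    Measurable (gap p h B y) := by
  have hd := (continuous_dotp_right y).measurable
  have hJ := (measurable_powUtil p).comp (hd.const_add 1)
  refine Measurable.ite ?_ (hB.sub (hJ.sub (hd.comp hh))).ennreal_ofReal measurable_const
  exact (measurableSet_lt measurable_const (hd.const_add 1)).union (MeasurableSet.const _)

lemma gap_add_posPart {y z : EuclideanSpace ℝ (Fin d)} (hB0 : 0 ≤ B z)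
    (hle : (0 < 1 + dotp y z ∨ 0 < p) → powUtil p (1 + dotp y z) - dotp y (h z) ≤ B z) :
    gap p h B y z + (Ifun p h y z).posPart
      = ENNReal.ofReal (B z) + (-(Ifun p h y z)).posPart := by
  rw [Ifun_eq, gap]
  split_ifs with hg
  · have hle := hle hg
    set I := powUtil p (1 + dotp y z) - dotp y (h z)
    have e2 : (-((I : ℝ) : EReal)).posPart = ENNReal.ofReal (-I) := by
      rw [← EReal.coe_neg, EReal.posPart_coe]
    rw [EReal.posPart_coe, e2]
    rcases le_total 0 I with hI | hI
    · rw [← ENNReal.ofReal_add (by linarith) hI, ENNReal.ofReal_of_nonpos (neg_nonpos.2 hI)]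
      simp
    · rw [← ENNReal.ofReal_add hB0 (by linarith), ENNReal.ofReal_of_nonpos hI]
      simp [sub_eq_add_neg]
  · simp [EReal.posPart]

lemma eIntegral_Ifun_eq (hh : Measurable h) (hB : Measurable B) (hB0 : ∀ z, 0 ≤ B z)
    (hBF : ∫⁻ z, ENNReal.ofReal (B z) ∂F ≠ ⊤) {y : EuclideanSpace ℝ (Fin d)}
    (hle : ∀ᵐ z ∂F, (0 < 1 + dotp y z ∨ 0 < p) →
      powUtil p (1 + dotp y z) - dotp y (h z) ≤ B z) :
    eIntegral F (fun z => Ifun p h y z) =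
      (((∫⁻ z, ENNReal.ofReal (B z) ∂F).toReal : ℝ) : EReal) - (∫⁻ z, gap p h B y z ∂F : ℝ≥0∞) := by
  have h1 : ∫⁻ z, gap p h B y z ∂F + ∫⁻ z, (Ifun p h y z).posPart ∂F
      = ∫⁻ z, ENNReal.ofReal (B z) ∂F + ∫⁻ z, (-(Ifun p h y z)).posPart ∂F := by
    rw [← lintegral_add_left (measurable_gap hh hB y), ← lintegral_add_left hB.ennreal_ofReal]
    exact lintegral_congr_ae (hle.mono fun z hz => gap_add_posPart (hB0 z) hz)
  have h2 : ∫⁻ z, (Ifun p h y z).posPart ∂F ≠ ⊤ := by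
    refine ne_top_of_le_ne_top hBF (lintegral_mono_ae (hle.mono fun z hz => ?_))
    rw [Ifun_eq]
    split_ifs with hg
    · rw [EReal.posPart_coe]
      exact ENNReal.ofReal_le_ofReal (hz hg)
    · simp [EReal.posPart]
  unfold eIntegral
  generalize ∫⁻ z, (Ifun p h y z).posPart ∂F = P at *
  generalize ∫⁻ z, (-(Ifun p h y z)).posPart ∂F = Q at *
  generalize ∫⁻ z, gap p h B y z ∂F = N at *
  generalize ∫⁻ z, ENNReal.ofReal (B z) ∂F = K at *
  lift P to ℝ≥0 using h2
  lift K to ℝ≥0 using hBF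
  induction Q with
  | top =>
    have : N = ⊤ := by
      rw [ENNReal.add_eq_top.2 (Or.inr rfl)] at h1
      simpa using h1
    subst this
    simp
  | coe Q =>
    have hN : N ≠ ⊤ := by rintro rfl; simp at h1; exact absurd h1.symm (by simp)
    lift N to ℝ≥0 using hN
    have h3 : (N : ℝ) + P = K + Q := by exact_mod_cast h1
    have h4 : (P : ℝ) - Q = K - N := by linarith
    have h5 : ((P - Q : ℝ) : EReal) = ((K - N : ℝ) : EReal) := by rw [h4]
    rw [EReal.coe_sub, EReal.coe_sub] at h5
    simpa [EReal.coe_nnreal_eq_coe_real] using h5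

lemma gap_convex (hp : p < 1) {x y z : EuclideanSpace ℝ (Fin d)} (hx : 0 ≤ 1 + dotp x z)
    (hy : 0 ≤ 1 + dotp y z) {a b : ℝ} (ha : 0 < a) (hb : 0 < b) (hab : a + b = 1) :
    gap p h B (a • x + b • y) z
      ≤ ENNReal.ofReal a * gap p h B x z + ENNReal.ofReal b * gap p h B y z := by
  by_cases gx : 0 < 1 + dotp x z ∨ 0 < p
  swap
  · have : gap p h B x z = ⊤ := if_neg gx
    simp [this, ENNReal.mul_top, ha]
  by_cases gy : 0 < 1 + dotp y z ∨ 0 < p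
  swap
  · have : gap p h B y z = ⊤ := if_neg gy
    simp [this, ENNReal.mul_top, hb]
  have e : 1 + dotp (a • x + b • y) z = a * (1 + dotp x z) + b * (1 + dotp y z) := by
    rw [dotp_combo]; linarith
  have gxy : 0 < 1 + dotp (a • x + b • y) z ∨ 0 < p := by
    rw [e]
    rcases gx with gx | gx
    · left; positivity
    · exact Or.inr gx
  simp only [gap, if_pos gx, if_pos gy, if_pos gxy]
  rw [← ENNReal.ofReal_mul ha.le, ← ENNReal.ofReal_mul hb.le]
  refine le_trans (ENNReal.ofReal_le_ofReal ?_) ENNReal.ofReal_add_le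
  rw [e, dotp_combo]
  have := powUtil_concave hp hx gx hy gy ha.le hb.le hab
  have e2 : B z = a * B z + b * B z := by rw [← add_mul, hab, one_mul]
  linarith

lemma lowerSemicontinuous_gap (z : EuclideanSpace ℝ (Fin d)) :
    LowerSemicontinuous fun y => gap p h B y z := by
  intro y
  have hw : Tendsto (fun x => 1 + dotp x z) (𝓝 y) (𝓝 (1 + dotp y z)) :=
    ((continuous_dotp_left z).const_add 1 |>.tendsto y)
  have hh : Tendsto (fun x => dotp x (h z)) (𝓝 y) (𝓝 (dotp y (h z))) :=
    (continuous_dotp_left (h z)).tendsto y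
  by_cases hg : 0 < 1 + dotp y z ∨ 0 < p
  · have hev : ∀ᶠ x in 𝓝 y, 0 < 1 + dotp x z ∨ 0 < p := by
      rcases hg with hg | hg
      · exact (hw.eventually (lt_mem_nhds hg)).mono fun x => Or.inl
      · exact Eventually.of_forall fun x => Or.inr hg
    have hc : ContinuousAt (fun y => gap p h B y z) y := by
      have h1 : Tendsto (fun x => ENNReal.ofReal (B z - (powUtil p (1 + dotp x z) - dotp x (h z))))
          (𝓝 y) (𝓝 (gap p h B y z)) := by
        rw [gap, if_pos hg]
        exact ENNReal.tendsto_ofReal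
          ((((continuousAt_powUtil hg).tendsto.comp hw).sub hh).const_sub _)
      exact h1.congr' (hev.mono fun x hx => (if_pos hx).symm)
    exact hc.lowerSemicontinuousAt
  · push Not at hg
    obtain ⟨hg, hp⟩ := hg
    intro M hM
    have hM : M ≠ ⊤ := (hM.trans_le le_top).ne
    lift M to ℝ≥0 using hM
    have h1 : ∀ᶠ w in 𝓝[>] (0 : ℝ), powUtil p w < B z + (dotp y (h z) - 1) - M :=
      (tendsto_powUtil_nhdsGT_zero hp).eventually (eventually_lt_atBot _)
    obtain ⟨e, he, hes⟩ := mem_nhdsGT_iff_exists_Ioo_subset.1 h1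
    filter_upwards [hw.eventually (gt_mem_nhds (hg.trans_lt he)),
      hh.eventually (lt_mem_nhds (sub_one_lt _))] with x hx1 hx2
    unfold gap
    split_ifs with hgx
    · have := hes ⟨hgx.resolve_right (not_lt.2 hp), hx1⟩
      simp only [mem_ofPred_eq] at this
      rw [← ENNReal.ofReal_coe_nnreal]
      have : (M : ℝ) < B z - (powUtil p (1 + dotp x z) - dotp x (h z)) := by linarith
      exact (ENNReal.ofReal_lt_ofReal_iff (M.2.trans_lt this)).2 this
    · exact ENNReal.coe_lt_top

lemma lowerSemicontinuous_lintegral_gap (hh : Measurable h) (hB : Measurable B)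
    (F : Measure (EuclideanSpace ℝ (Fin d))) :
    LowerSemicontinuous fun y => ∫⁻ z, gap p h B y z ∂F := by
  refine fun y => lowerSemicontinuousAt_iff_le_liminf.2 ?_
  refine le_trans (lintegral_mono fun z => ?_)
    (lintegral_liminf_le' fun x => (measurable_gap hh hB x).aemeasurable)
  exact lowerSemicontinuousAt_iff_le_liminf.1 (lowerSemicontinuous_gap z y)

lemma lintegral_gap_convex (hp : p < 1) (hh : Measurable h) (hB : Measurable B)
    {x y : EuclideanSpace ℝ (Fin d)}
    (hx : ∀ᵐ z ∂F, 0 ≤ 1 + dotp x z) (hy : ∀ᵐ z ∂F, 0 ≤ 1 + dotp y z) {a b : ℝ} (ha : 0 < a)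
    (hb : 0 < b) (hab : a + b = 1) :
    ∫⁻ z, gap p h B (a • x + b • y) z ∂F
      ≤ ENNReal.ofReal a * ∫⁻ z, gap p h B x z ∂F + ENNReal.ofReal b * ∫⁻ z, gap p h B y z ∂F := by
  rw [← lintegral_const_mul _ (measurable_gap hh hB x),
    ← lintegral_const_mul _ (measurable_gap hh hB y),
    ← lintegral_add_left ((measurable_gap hh hB x).const_mul _)]
  refine lintegral_mono_ae ?_
  filter_upwards [hx, hy] with z h1 h2 using gap_convex hp h1 h2 ha hb hab

end Integrand

section Standing

variable {d : ℕ} {p ε : ℝ} {h : EuclideanSpace ℝ (Fin d) → EuclideanSpace ℝ (Fin d)}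
  {Θ : Set (Triple d)} {C : Set (EuclideanSpace ℝ (Fin d))}

lemma Standing.lt_one (SA : Standing p ε h Θ C) : p < 1 := by
  rcases SA.p_range with h | h | h <;> linarith

lemma Standing.exists_dominating (SA : Standing p ε h Θ C) {R : ℝ} (hR : 0 ≤ R) :
    ∃ B : EuclideanSpace ℝ (Fin d) → ℝ, Measurable B ∧ (∀ z, 0 ≤ B z) ∧
      (∀ θ ∈ Θ, ∫⁻ z, ENNReal.ofReal (B z) ∂θ.2.2 ≠ ⊤) ∧
      ∀ y, ‖y‖ ≤ R → ∀ z, 0 ≤ 1 + dotp y z → (0 < 1 + dotp y z ∨ 0 < p) →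
        powUtil p (1 + dotp y z) - dotp y (h z) ≤ B z := by
  obtain ⟨M, hM⟩ := SA.trunc.bounded
  obtain ⟨δ, hδ, hid⟩ := SA.trunc.eq_id_near_zero
  have hM0 : 0 ≤ M := (norm_nonneg _).trans (hM 0)
  obtain ⟨A, hA, hAw⟩ := exists_mul_radialWeight_ge (M := R * M) SA.lt_one SA.eps_pos hδ hR
    (mul_nonneg hR hM0)
  refine ⟨fun z => A * Kintegrand p ε z, ?_, ?_, ?_, ?_⟩
  · exact ((measurable_radialWeight p ε).comp measurable_norm).const_mul A
  · exact fun z => mul_nonneg hA (radialWeight_nonneg p ε (norm_nonneg z))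
  · intro θ hθ
    obtain ⟨K, hK⟩ := SA.K_finite
    simp only [ENNReal.ofReal_mul hA]
    rw [lintegral_const_mul' _ _ ENNReal.ofReal_ne_top]
    exact ENNReal.mul_ne_top ENNReal.ofReal_ne_top (hK θ hθ).1
  · intro y hy z hw hg
    have hyz := abs_le.1 (abs_dotp_le y z)
    rcases lt_or_ge ‖z‖ δ with hz | hz
    · rw [hid z hz]
      have h1 := powUtil_le SA.lt_one hw hg
      have h2 := mul_nonneg hA (radialWeight_nonneg p ε (norm_nonneg z))
      change _ ≤ A * radialWeight p ε ‖z‖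
      linarith
    · have h1 : 1 + dotp y z ≤ 1 + R * ‖z‖ := by
        have := mul_le_mul_of_nonneg_right hy (norm_nonneg z)
        linarith
      have h2 : -dotp y (h z) ≤ R * M := by
        have h3 := (abs_le.1 (abs_dotp_le y (h z))).1
        have h4 := mul_le_mul hy (hM z) (norm_nonneg _) hR
        linarith
      have := hAw ‖z‖ hz _ hw h1 hg
      change _ ≤ A * radialWeight p ε ‖z‖
      linarith

lemma ae_nonneg_of_mem_natC {y : EuclideanSpace ℝ (Fin d)} (hy : y ∈ natC Θ) {θ : Triple d}
    (hθ : θ ∈ Θ) : ∀ᵐ z ∂θ.2.2, 0 ≤ 1 + dotp y z := by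
  rw [ae_iff]
  convert hy θ hθ using 3
  ext z
  constructor <;> intro hz <;> simp only [not_le] at * <;> linarith

lemma convex_natC (Θ : Set (Triple d)) : Convex ℝ (natC Θ) := by
  intro x hx y hy a b ha hb hab θ hθ
  refine measure_mono_null ?_ (measure_union_null (hx θ hθ) (hy θ hθ))
  intro z hz
  simp only [mem_ofPred_eq, mem_union] at hz ⊢
  rw [dotp_combo] at hz
  by_contra! hcon
  nlinarith [mul_le_mul_of_nonneg_left hcon.1 ha, mul_le_mul_of_nonneg_left hcon.2 hb]

lemma zero_mem_natC (Θ : Set (Triple d)) : (0 : EuclideanSpace ℝ (Fin d)) ∈ natC Θ := by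
  intro θ _
  convert measure_empty (μ := θ.2.2)
  ext z
  simp [dotp]

/-- The finite part of `gTheta` once a dominating function `B` is split off. -/
def finitePart (p : ℝ) (B : EuclideanSpace ℝ (Fin d) → ℝ) (θ : Triple d)
    (y : EuclideanSpace ℝ (Fin d)) : ℝ :=
  dotp y θ.1 + (p - 1) / 2 * quadf θ.2.1 y + (∫⁻ z, ENNReal.ofReal (B z) ∂θ.2.2).toReal

lemma continuous_finitePart (p : ℝ) (B : EuclideanSpace ℝ (Fin d) → ℝ) (θ : Triple d) :
    Continuous (finitePart p B θ) :=
  ((continuous_dotp_left _).add ((continuous_quadf _).const_mul _)).add_const _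

lemma le_finitePart_combo (hp : p < 1) {B : EuclideanSpace ℝ (Fin d) → ℝ} {θ : Triple d}
    (hc : θ.2.1.PosSemidef) {a b : ℝ} (ha : 0 ≤ a) (hb : 0 ≤ b) (hab : a + b = 1)
    (x y : EuclideanSpace ℝ (Fin d)) :
    a * finitePart p B θ x + b * finitePart p B θ y ≤ finitePart p B θ (a • x + b • y) := by
  unfold finitePart
  rw [dotp_combo]
  have h1 := mul_le_mul_of_nonpos_left (quadf_convex hc ha hb hab x y)
    (by linarith : (p - 1) / 2 ≤ 0)
  set K := (∫⁻ z, ENNReal.ofReal (B z) ∂θ.2.2).toReal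
  have h2 : a * K + b * K = K := by rw [← add_mul, hab, one_mul]
  linarith

lemma upperSemicontinuous_coe_sub {X : Type*} [TopologicalSpace X] {L : X → ℝ} {N : X → ℝ≥0∞}
    (hL : Continuous L) (hN : LowerSemicontinuous N) :
    UpperSemicontinuous fun x => (L x : EReal) - (N x : EReal) := by
  intro x
  have h1 : UpperSemicontinuousAt (fun x => (L x : EReal)) x :=
    (continuous_coe_real_ereal.comp hL).continuousAt.upperSemicontinuousAt
  have hneg : Continuous fun a : ℝ≥0∞ => -(a : EReal) :=
    continuous_neg.comp continuous_coe_ennreal_ereal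
  have h2 : UpperSemicontinuousAt (fun x => -(N x : EReal)) x :=
    hneg.continuousAt.comp_lowerSemicontinuousAt_antitone
      (hN x) (fun a b hab => EReal.neg_le_neg_iff.2 (EReal.coe_ennreal_le_coe_ennreal_iff.2 hab))
  simp only [sub_eq_add_neg]
  exact h1.add' h2
    (EReal.continuousAt_add (Or.inl (EReal.coe_ne_top _)) (Or.inl (EReal.coe_ne_bot _)))

lemma erealConcaveOn_coe_sub {E : Type*} [AddCommGroup E] [Module ℝ E] {X : Set E} {L : E → ℝ}
    {N : E → ℝ≥0∞}
    (hL : ∀ x ∈ X, ∀ y ∈ X, ∀ a b : ℝ, 0 < a → 0 < b → a + b = 1 →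
      a * L x + b * L y ≤ L (a • x + b • y))
    (hN : ∀ x ∈ X, ∀ y ∈ X, ∀ a b : ℝ, 0 < a → 0 < b → a + b = 1 →
      N (a • x + b • y) ≤ ENNReal.ofReal a * N x + ENNReal.ofReal b * N y) :
    ERealConcaveOn X fun x => (L x : EReal) - (N x : EReal) := by
  intro x hx y hy a b ha hb hab r s hr hs
  rcases ha.eq_or_lt with rfl | ha
  · obtain rfl : b = 1 := by linarith
    simpa using hs
  rcases hb.eq_or_lt with rfl | hb
  · obtain rfl : a = 1 := by linarith
    simpa using hr
  have key : ∀ (x : E) (r : ℝ), (r : EReal) ≤ (L x : EReal) - (N x : EReal) ↔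
      N x ≤ ENNReal.ofReal (L x - r) ∧ r ≤ L x := by
    intro x r
    generalize N x = n
    induction n with
    | top => simp
    | coe n =>
      rw [EReal.coe_nnreal_eq_coe_real, ← EReal.coe_sub, EReal.coe_le_coe_iff]
      constructor
      · intro h
        have hn := n.2
        refine ⟨?_, by linarith [show (0 : ℝ) ≤ n from hn]⟩
        rw [← ENNReal.ofReal_coe_nnreal]
        exact ENNReal.ofReal_le_ofReal (by linarith)
      · rintro ⟨h1, h2⟩
        rw [← ENNReal.ofReal_coe_nnreal, ENNReal.ofReal_le_ofReal_iff (by linarith)] at h1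
        linarith
  rw [key] at hr hs ⊢
  have hl := hL x hx y hy a b ha hb hab
  have h1 := mul_le_mul_of_nonneg_left hr.2 ha.le
  have h2 := mul_le_mul_of_nonneg_left hs.2 hb.le
  refine ⟨(hN x hx y hy a b ha hb hab).trans ?_, by linarith⟩
  calc _ ≤ ENNReal.ofReal a * ENNReal.ofReal (L x - r)
        + ENNReal.ofReal b * ENNReal.ofReal (L y - s) := by
        gcongr
        · exact hr.1
        · exact hs.1
    _ = ENNReal.ofReal (a * (L x - r) + b * (L y - s)) := by
        rw [← ENNReal.ofReal_mul ha.le, ← ENNReal.ofReal_mul hb.le, ENNReal.ofReal_add]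
        · nlinarith
        · nlinarith
    _ ≤ _ := ENNReal.ofReal_le_ofReal (by linarith)

lemma coe_sub_mixture {t L₁ L₂ : ℝ} (ht0 : 0 < t) (ht1 : t < 1) (N₁ N₂ : ℝ≥0∞) :
    ((t * L₁ + (1 - t) * L₂ : ℝ) : EReal)
        - ((ENNReal.ofReal t * N₁ + ENNReal.ofReal (1 - t) * N₂ : ℝ≥0∞) : EReal)
      = (t : EReal) * ((L₁ : EReal) - N₁) + ((1 - t : ℝ) : EReal) * ((L₂ : EReal) - N₂) := by
  have ht1' : 0 < 1 - t := sub_pos.2 ht1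
  induction N₁ with
  | top =>
    rw [ENNReal.mul_top (by simpa using ht0), top_add]
    simp [EReal.coe_mul_bot_of_pos ht0]
  | coe n₁ =>
    induction N₂ with
    | top =>
      rw [ENNReal.mul_top (by simpa using ht1'), add_top, EReal.coe_ennreal_top, EReal.sub_top,
        EReal.sub_top, EReal.coe_mul_bot_of_pos ht1', EReal.add_bot]
    | coe n₂ =>
      rw [← ENNReal.ofReal_coe_nnreal, ← ENNReal.ofReal_coe_nnreal, ← ENNReal.ofReal_mul ht0.le,
        ← ENNReal.ofReal_mul ht1'.le, ← ENNReal.ofReal_add (by positivity) (by positivity)]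
      rw [EReal.coe_ennreal_ofReal, EReal.coe_ennreal_ofReal, EReal.coe_ennreal_ofReal,
        max_eq_left (by positivity), max_eq_left (by positivity), max_eq_left (by positivity)]
      norm_cast
      ring

end Standing

/-- Under the standing assumptions, there exists `yhat ∈ C ∩ C⁰` such that
`inf_{θ ∈ Θ} g^θ(yhat) = sup_{y ∈ C ∩ C⁰} inf_{θ ∈ Θ} g^θ(y)
 = inf_{θ ∈ Θ} sup_{y ∈ C ∩ C⁰} g^θ(y)`. -/
theorem stmt10 {d : ℕ} (hd : 1 ≤ d) (p ε : ℝ)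
    (h : EuclideanSpace ℝ (Fin d) → EuclideanSpace ℝ (Fin d))
    (Θ : Set (Triple d)) (C : Set (EuclideanSpace ℝ (Fin d)))
    (SA : Standing p ε h Θ C) :
    ∃ yhat ∈ C ∩ natC Θ,
      (⨅ θ ∈ Θ, gTheta p h θ yhat) = (⨆ y ∈ C ∩ natC Θ, ⨅ θ ∈ Θ, gTheta p h θ y) ∧
      (⨆ y ∈ C ∩ natC Θ, ⨅ θ ∈ Θ, gTheta p h θ y) =
        (⨅ θ ∈ Θ, ⨆ y ∈ C ∩ natC Θ, gTheta p h θ y) := by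
  obtain ⟨R, hR0, hR⟩ : ∃ R : ℝ, 0 ≤ R ∧ ∀ y ∈ C ∩ natC Θ, ‖y‖ ≤ R := by
    obtain ⟨R, hR⟩ := SA.CC0_compact.isBounded.exists_norm_le
    exact ⟨max R 0, le_max_right _ _, fun y hy => (hR y hy).trans (le_max_left _ _)⟩
  obtain ⟨B, hBm, hB0, hBfin, hBle⟩ := SA.exists_dominating hR0
  have hh := SA.trunc.measurable
  have hg : ∀ θ ∈ Θ, ∀ y ∈ C ∩ natC Θ, gTheta p h θ y
      = (finitePart p B θ y : EReal) - (∫⁻ z, gap p h B y z ∂θ.2.2 : ℝ≥0∞) := by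
    intro θ hθ y hy
    rw [gTheta, gfun, eIntegral_Ifun_eq hh hBm hB0 (hBfin θ hθ)
      ((ae_nonneg_of_mem_natC hy.2 hθ).mono fun z hz => hBle y (hR y hy) z hz),
      finitePart, EReal.coe_add _ (ENNReal.toReal _)]
    simp only [fun a b : EReal => sub_eq_add_neg a b, add_assoc]
  refine exists_minimax SA.Theta_nonempty ⟨0, SA.C_zero, zero_mem_natC Θ⟩ SA.CC0_compact
    (SA.C_convex.inter (convex_natC Θ)) ?_ ?_ ?_ ?_
  · intro θ hθ
    have husc := upperSemicontinuous_coe_sub (continuous_finitePart p B θ)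
      (lowerSemicontinuous_lintegral_gap (p := p) hh hBm θ.2.2)
    intro y hy c hc
    rw [hg θ hθ y hy] at hc
    filter_upwards [husc.upperSemicontinuousOn _ y hy c hc, self_mem_nhdsWithin] with x hx hxX
    rwa [hg θ hθ x hxX]
  · intro θ hθ y hy
    rw [hg θ hθ y hy, sub_eq_add_neg]
    exact EReal.add_lt_top (EReal.coe_ne_top _) (by simp)
  · intro θ hθ
    have hc : ERealConcaveOn (C ∩ natC Θ) fun y =>
        (finitePart p B θ y : EReal) - (∫⁻ z, gap p h B y z ∂θ.2.2 : ℝ≥0∞) :=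
      erealConcaveOn_coe_sub
        (fun x _ y _ a b ha hb hab =>
          le_finitePart_combo SA.lt_one (SA.Theta_psd θ hθ) ha.le hb.le hab x y)
        (fun x hx y hy a b ha hb hab => lintegral_gap_convex SA.lt_one hh hBm
          (ae_nonneg_of_mem_natC hx.2 hθ) (ae_nonneg_of_mem_natC hy.2 hθ) ha hb hab)
    intro x hx y hy a b ha hb hab r s hr hs
    rw [hg θ hθ x hx] at hr
    rw [hg θ hθ y hy] at hs
    rw [hg θ hθ _ ((SA.C_convex.inter (convex_natC Θ)) hx hy ha hb hab)]
    exact hc x hx y hy a b ha hb hab r s hr hs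
  · intro θ₁ hθ₁ θ₂ hθ₂ t ht0 ht1
    have hθ := SA.Theta_convex θ₁ hθ₁ θ₂ hθ₂ t ht0.le ht1.le
    refine ⟨_, hθ, fun y hy => le_of_eq ?_⟩
    rw [hg _ hθ y hy, hg _ hθ₁ y hy, hg _ hθ₂ y hy, ← coe_sub_mixture ht0 ht1]
    have hfin : ∀ θ ∈ Θ, ∀ s : ℝ, ENNReal.ofReal s * ∫⁻ z, ENNReal.ofReal (B z) ∂θ.2.2 ≠ ⊤ :=
      fun θ hθ s => ENNReal.mul_ne_top ENNReal.ofReal_ne_top (hBfin θ hθ)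
    simp only [finitePart, lintegral_add_measure, lintegral_smul_measure, smul_eq_mul]
    rw [ENNReal.toReal_add (hfin _ hθ₁ _) (hfin _ hθ₂ _), ENNReal.toReal_mul, ENNReal.toReal_mul,
      ENNReal.toReal_ofReal ht0.le, ENNReal.toReal_ofReal (sub_pos.2 ht1).le, dotp_combo_right,
      quadf_combo_matrix]
    congr 2
    ring
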